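/- Suppose g : ℝ → ℝ → ℝ satisfies: for all a, b, c ∈ ℝ, |g(a,b) − g(a,c)| ≤ |b − c|. Then the generalized Bellman optimality operator F* has a unique fixed point Q* : S × A → ℝ (i.e., F*Q* = Q* and any Q with F*Q = Q equals Q*), and for every initial value function Q⁰ : S × A → ℝ, the sequence of iterates (F*)ⁿ Q⁰ converges to Q* as n → ∞. -/

import Mathlib

open Finset Filter

theorem Finset.abs_sup'_sub_sup'_le {ι : Type*} {s : Finset ι} (hs : s.Nonempty)
    {f h : ι → ℝ} {d : ℝ} (hd : ∀ i ∈ s, |f i - h i| ≤ d) :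
    |s.sup' hs f - s.sup' hs h| ≤ d := by
  rw [abs_sub_le_iff, sub_le_iff_le_add, sub_le_iff_le_add]
  constructor <;> refine Finset.sup'_le hs _ fun i hi => ?_
  · linarith [Finset.le_sup' h hi, (abs_sub_le_iff.1 (hd i hi)).1]
  · linarith [Finset.le_sup' f hi, (abs_sub_le_iff.1 (hd i hi)).2]

theorem Finset.abs_sum_mul_sub_sum_mul_le {ι : Type*} {s : Finset ι} {w f h : ι → ℝ} {d : ℝ}
    (hw : ∀ i ∈ s, 0 ≤ w i) (hw_sum : ∑ i ∈ s, w i = 1) (hd : ∀ i ∈ s, |f i - h i| ≤ d) :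
    |∑ i ∈ s, w i * f i - ∑ i ∈ s, w i * h i| ≤ d := by
  rw [← Finset.sum_sub_distrib]
  calc |∑ i ∈ s, (w i * f i - w i * h i)|
      ≤ ∑ i ∈ s, |w i * f i - w i * h i| := Finset.abs_sum_le_sum_abs _ _
    _ ≤ ∑ i ∈ s, w i * d := by
        refine Finset.sum_le_sum fun i hi => ?_
        rw [← mul_sub, abs_mul, abs_of_nonneg (hw i hi)]
        exact mul_le_mul_of_nonneg_left (hd i hi) (hw i hi)
    _ = d := by rw [← Finset.sum_mul, hw_sum, one_mul]

theorem generalized_bellman_optimality_operator_fixed_point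
    {S A R : Type*} [Fintype S] [Nonempty S] [Fintype A] [Nonempty A] [Fintype R]
    (ρ : R → ℝ) (p : S × A → R × S → ℝ)
    (hp_nonneg : ∀ sa : S × A, ∀ x : R × S, 0 ≤ p sa x)
    (hp_sum : ∀ sa : S × A, ∑ x : R × S, p sa x = 1)
    (γ : ℝ) (hγ : γ ∈ Set.Ioo (0 : ℝ) 1)
    (g : ℝ → ℝ → ℝ)
    (hg : ∀ a b c : ℝ, |g a b - g a c| ≤ |b - c|)
    (Fstar : (S × A → ℝ) → (S × A → ℝ))
    (hFstar : ∀ (Q : S × A → ℝ) (sa : S × A),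
      Fstar Q sa = ∑ x : R × S,
        p sa x * g (ρ x.1) (γ * univ.sup' univ_nonempty (fun a' => Q (x.2, a')))) :
    ∃ Qstar : S × A → ℝ,
      Fstar Qstar = Qstar ∧
      (∀ Q : S × A → ℝ, Fstar Q = Q → Q = Qstar) ∧
      (∀ Q0 : S × A → ℝ, Tendsto (fun n => Fstar^[n] Q0) atTop (nhds Qstar)) := by
  obtain ⟨hγ_pos, hγ_lt⟩ := hγ
  have hF : ContractingWith ⟨γ, hγ_pos.le⟩ Fstar := by
    refine ⟨hγ_lt, LipschitzWith.of_dist_le_mul fun P Q => ?_⟩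
    change dist (Fstar P) (Fstar Q) ≤ γ * dist P Q
    refine (dist_pi_le_iff (by positivity)).2 fun sa => ?_
    rw [Real.dist_eq, hFstar, hFstar]
    refine Finset.abs_sum_mul_sub_sum_mul_le (fun x _ => hp_nonneg sa x) (hp_sum sa)
      fun x _ => (hg _ _ _).trans ?_
    rw [← mul_sub, abs_mul, abs_of_pos hγ_pos]
    refine mul_le_mul_of_nonneg_left ?_ hγ_pos.le
    exact Finset.abs_sup'_sub_sup'_le _ fun a _ => dist_le_pi_dist P Q (x.2, a)
  exact ⟨hF.fixedPoint Fstar, hF.fixedPoint_isFixedPt, fun Q hQ => hF.fixedPoint_unique hQ,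
    hF.tendsto_iterate_fixedPoint⟩
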